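/- arXiv:1403.6665 — 5 statements merged into one kernel-verified Lean document; each statement's English description precedes it below -/
import Mathlib

section
/- Let a = −2a₁e₁ + 2a₂e₂ − a₃e₃ − 2a₄e₄ + 2a₅e₅ − a₆e₆ ∈ ℝ⁶ with Q(a) ≠ 0, and for (x, y) ∈ ℝ² let 𝔩 = 2y e₂ − 2x e₅ ∈ ℝ⁶ (the line through the origin and (x, y)). Set W = ½(ι(𝔩)·ι(a) − ι(a)·ι(𝔩)) ∈ Cl(4,2) (the outer product 𝔩 ∧ a, representing the pair of common points of the line and the conic). Then the inversion induced by a fixes W: ι(a) · W · ι(a) = −Q(a) • W, equivalently α(ι(a)) · W · (Q(a)⁻¹ • ι(a)) = W. -/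
/-- The bilinear form on `ℝ⁶` whose matrix has entries `B₂₂ = B₅₅ = 1`,
`B₁₃ = B₃₁ = B₄₆ = B₆₄ = −1` (indices 0-based here). -/
noncomputable def B6 : LinearMap.BilinMap ℝ (Fin 6 → ℝ) ℝ :=
  LinearMap.mk₂ ℝ
    (fun u w => u 1 * w 1 + u 4 * w 4 - u 0 * w 2 - u 2 * w 0 - u 3 * w 5 - u 5 * w 3)
    (by intros; simp only [Pi.add_apply]; ring)
    (by intros; simp only [Pi.smul_apply, smul_eq_mul]; ring)
    (by intros; simp only [Pi.add_apply]; ring)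
    (by intros; simp only [Pi.smul_apply, smul_eq_mul]; ring)

/-- The quadratic form `Q(v) = v₂² + v₅² − 2v₁v₃ − 2v₄v₆` on `ℝ⁶`, of signature `(4,2)`. -/
noncomputable def Q6 : QuadraticForm ℝ (Fin 6 → ℝ) := B6.toQuadraticMap

/-- The standard basis of `ℝ⁶`; `e i` corresponds to `e_{i+1}` in the paper. -/
noncomputable def e (i : Fin 6) : Fin 6 → ℝ := Pi.single i 1

open CliffordAlgebra

/-- The conic vector `a = −2a₁e₁ + 2a₂e₂ − a₃e₃ − 2a₄e₄ + 2a₅e₅ − a₆e₆`. -/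
noncomputable def conicVec (a₁ a₂ a₃ a₄ a₅ a₆ : ℝ) : Fin 6 → ℝ :=
  (-2 * a₁) • e 0 + (2 * a₂) • e 1 + (-a₃) • e 2 +
    (-2 * a₄) • e 3 + (2 * a₅) • e 4 + (-a₆) • e 5

/-- The line `𝔩 = 2y e₂ − 2x e₅` through the origin and `(x, y)`. -/
noncomputable def originLine (x y : ℝ) : Fin 6 → ℝ := (2 * y) • e 1 + (-2 * x) • e 4

namespace CliffordAlgebra

variable {R M : Type*} [CommRing R] [AddCommGroup M] [Module R M] {Q : QuadraticForm R M}

/-- Conjugating the commutator of a vector `v` with `a` by `a` multiplies it by `-Q a`. -/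
theorem ι_mul_commutator_mul_ι (a v : M) :
    ι Q a * (ι Q v * ι Q a - ι Q a * ι Q v) * ι Q a =
      (-(Q a)) • (ι Q v * ι Q a - ι Q a * ι Q v) := by
  calc
    ι Q a * (ι Q v * ι Q a - ι Q a * ι Q v) * ι Q a =
        ι Q a * ι Q v * (ι Q a * ι Q a) - (ι Q a * ι Q a) * (ι Q v * ι Q a) := by
      noncomm_ring
    _ = (-(Q a)) • (ι Q v * ι Q a - ι Q a * ι Q v) := by
      rw [ι_sq_scalar, ← Algebra.commutes, ← Algebra.smul_def, ← Algebra.smul_def, neg_smul,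
        smul_sub, neg_sub]

end CliffordAlgebra

/-- the inversion induced by a conic `a` fixes the outer product
`W = 𝔩 ∧ a` of `a` with any line through the origin:
`ι(a)·W·ι(a) = −Q(a) • W`, equivalently `α(ι(a))·W·(Q(a)⁻¹ • ι(a)) = W`. -/
theorem inversion_fixes_common_point_pair (a₁ a₂ a₃ a₄ a₅ a₆ x y : ℝ)
    (ha : Q6 (conicVec a₁ a₂ a₃ a₄ a₅ a₆) ≠ 0) :
    (ι Q6 (conicVec a₁ a₂ a₃ a₄ a₅ a₆) *
        ((1 / 2 : ℝ) • (ι Q6 (originLine x y) * ι Q6 (conicVec a₁ a₂ a₃ a₄ a₅ a₆) -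
          ι Q6 (conicVec a₁ a₂ a₃ a₄ a₅ a₆) * ι Q6 (originLine x y))) *
        ι Q6 (conicVec a₁ a₂ a₃ a₄ a₅ a₆) =
      (-(Q6 (conicVec a₁ a₂ a₃ a₄ a₅ a₆))) •
        ((1 / 2 : ℝ) • (ι Q6 (originLine x y) * ι Q6 (conicVec a₁ a₂ a₃ a₄ a₅ a₆) -
          ι Q6 (conicVec a₁ a₂ a₃ a₄ a₅ a₆) * ι Q6 (originLine x y)))) ∧
    involute (ι Q6 (conicVec a₁ a₂ a₃ a₄ a₅ a₆)) *
        ((1 / 2 : ℝ) • (ι Q6 (originLine x y) * ι Q6 (conicVec a₁ a₂ a₃ a₄ a₅ a₆) -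
          ι Q6 (conicVec a₁ a₂ a₃ a₄ a₅ a₆) * ι Q6 (originLine x y))) *
        ((Q6 (conicVec a₁ a₂ a₃ a₄ a₅ a₆))⁻¹ • ι Q6 (conicVec a₁ a₂ a₃ a₄ a₅ a₆)) =
      (1 / 2 : ℝ) • (ι Q6 (originLine x y) * ι Q6 (conicVec a₁ a₂ a₃ a₄ a₅ a₆) -
        ι Q6 (conicVec a₁ a₂ a₃ a₄ a₅ a₆) * ι Q6 (originLine x y)) := by
  have h := ι_mul_commutator_mul_ι (Q := Q6) (conicVec a₁ a₂ a₃ a₄ a₅ a₆) (originLine x y)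
  constructor
  · rw [mul_smul_comm, smul_mul_assoc, h, smul_comm]
  · rw [involute_ι, mul_smul_comm, mul_smul_comm, smul_mul_assoc, neg_mul, neg_mul, h, neg_smul,
      neg_neg, smul_comm, inv_smul_smul₀ ha]
end

section
/- Let a = 2a₁e₁ + ½a₀e₃ + 2a₄e₄ + ½a₀e₆ ∈ ℝ⁶ with a₀ ≠ 0 and a₁ + a₄ ≠ 0 (so Q(a) = −2a₀(a₁ + a₄) ≠ 0), and let 𝔩 = −2(y₁ − y₂)e₂ + (x₁y₂ − y₁x₂)e₃ + 2(x₁ − x₂)e₅ + (x₁y₂ − y₁x₂)e₆ be the line vector through (x₁, y₁) and (x₂, y₂). Then with D = x₁y₂ − y₁x₂, the inversion of the line in the conic a satisfies α(ι(a)) · ι(𝔩) · (Q(a)⁻¹ • ι(a)) = ι(−(4a₁D/a₀)e₁ − 2(y₁ − y₂)e₂ − (4a₄D/a₀)e₄ + 2(x₁ − x₂)e₅); in particular the image of a line is again a vector, i.e. an axis-aligned conic. -/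
open CliffordAlgebra

/-- The centered conic vector `a = 2a₁e₁ + ½a₀e₃ + 2a₄e₄ + ½a₀e₆`. -/
noncomputable def centeredConic (a₀ a₁ a₄ : ℝ) : Fin 6 → ℝ :=
  (2 * a₁) • e 0 + (a₀ / 2) • e 2 + (2 * a₄) • e 3 + (a₀ / 2) • e 5

/-- The line vector `𝔩 = −2(y₁ − y₂)e₂ + (x₁y₂ − y₁x₂)e₃ + 2(x₁ − x₂)e₅ + (x₁y₂ − y₁x₂)e₆`. -/
noncomputable def lineVec (x₁ y₁ x₂ y₂ : ℝ) : Fin 6 → ℝ :=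
  (-2 * (y₁ - y₂)) • e 1 + (x₁ * y₂ - y₁ * x₂) • e 2 +
    (2 * (x₁ - x₂)) • e 4 + (x₁ * y₂ - y₁ * x₂) • e 5

theorem CliffordAlgebra.involute_ι_mul_ι_mul_inv_smul_ι {K M : Type*} [Field K] [AddCommGroup M]
    [Module K M] {Q : QuadraticForm K M} {a : M} (ha : Q a ≠ 0) (b : M) :
    involute (ι Q a) * ι Q b * ((Q a)⁻¹ • ι Q a) =
      ι Q (b - (QuadraticMap.polar Q a b / Q a) • a) := by
  rw [involute_ι, mul_smul_comm, neg_mul, neg_mul, ι_mul_ι_mul_ι, ← map_neg, ← map_smul, neg_sub,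
    smul_sub, smul_smul, smul_smul, inv_mul_cancel₀ ha, one_smul, div_eq_inv_mul]

theorem Q6_apply (v : Fin 6 → ℝ) :
    Q6 v = v 1 ^ 2 + v 4 ^ 2 - 2 * v 0 * v 2 - 2 * v 3 * v 5 := by
  simp only [Q6, B6, LinearMap.BilinMap.toQuadraticMap_apply, LinearMap.mk₂_apply]
  ring

theorem polar_Q6 (u w : Fin 6 → ℝ) :
    QuadraticMap.polar Q6 u w =
      2 * (u 1 * w 1 + u 4 * w 4 - u 0 * w 2 - u 2 * w 0 - u 3 * w 5 - u 5 * w 3) := by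
  simp only [QuadraticMap.polar, Q6_apply, Pi.add_apply]
  ring

theorem Q6_centeredConic (a₀ a₁ a₄ : ℝ) :
    Q6 (centeredConic a₀ a₁ a₄) = -2 * a₀ * (a₁ + a₄) := by
  rw [Q6_apply]
  simp [centeredConic, e]
  ring

theorem polar_Q6_centeredConic_lineVec (a₀ a₁ a₄ x₁ y₁ x₂ y₂ : ℝ) :
    QuadraticMap.polar Q6 (centeredConic a₀ a₁ a₄) (lineVec x₁ y₁ x₂ y₂) =
      -4 * (x₁ * y₂ - y₁ * x₂) * (a₁ + a₄) := by
  rw [polar_Q6]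
  simp [centeredConic, lineVec, e]
  ring

/-- the image of a line under inversion in a centered conic is again a
vector (an axis-aligned conic), given explicitly with `D = x₁y₂ − y₁x₂` by
`−(4a₁D/a₀)e₁ − 2(y₁ − y₂)e₂ − (4a₄D/a₀)e₄ + 2(x₁ − x₂)e₅`.  Here
`Q(a) = −2a₀(a₁ + a₄) ≠ 0`. -/
theorem inversion_of_line_is_conic (a₀ a₁ a₄ x₁ y₁ x₂ y₂ : ℝ)
    (h₀ : a₀ ≠ 0) (h₁₄ : a₁ + a₄ ≠ 0) :
    Q6 (centeredConic a₀ a₁ a₄) = -2 * a₀ * (a₁ + a₄) ∧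
    involute (ι Q6 (centeredConic a₀ a₁ a₄)) * ι Q6 (lineVec x₁ y₁ x₂ y₂) *
        ((Q6 (centeredConic a₀ a₁ a₄))⁻¹ • ι Q6 (centeredConic a₀ a₁ a₄)) =
      ι Q6 ((-(4 * a₁ * (x₁ * y₂ - y₁ * x₂) / a₀)) • e 0 + (-2 * (y₁ - y₂)) • e 1 +
        (-(4 * a₄ * (x₁ * y₂ - y₁ * x₂) / a₀)) • e 3 + (2 * (x₁ - x₂)) • e 4) := by
  have hQ : Q6 (centeredConic a₀ a₁ a₄) ≠ 0 := by
    rw [Q6_centeredConic]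
    exact mul_ne_zero (mul_ne_zero (by norm_num) h₀) h₁₄
  refine ⟨Q6_centeredConic a₀ a₁ a₄, ?_⟩
  have hc : -4 * (x₁ * y₂ - y₁ * x₂) * (a₁ + a₄) / (-2 * a₀ * (a₁ + a₄)) =
      2 * (x₁ * y₂ - y₁ * x₂) / a₀ := by
    field_simp
    ring
  rw [involute_ι_mul_ι_mul_inv_smul_ι hQ, polar_Q6_centeredConic_lineVec, Q6_centeredConic, hc,
    centeredConic, lineVec]
  congr 1
  match_scalars <;> field_simp <;> ring
end

section
/- In Cl(4,2), set E = ι(e₂)ι(e₅), g = ι(e₂)ι(e₃) + ι(e₂)ι(e₆), and f = ι(e₃)ι(e₅) − ι(e₅)ι(e₆). Then the multiplication table of planar displacements holds: E² = −1, E·g = f, g·E = −f, E·f = −g, f·E = g, g² = 0, f² = 0, g·f = 0, and f·g = 0. (Hence span{1, E, g, f} is a subalgebra isomorphic to the planar dual quaternions via E ↦ i, g ↦ εj, f ↦ εk.) -/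
open CliffordAlgebra

/-- `E = e₂e₅`. -/
noncomputable def E : CliffordAlgebra Q6 := ι Q6 (e 1) * ι Q6 (e 4)

/-- `g = e₂e₃ + e₂e₆`, corresponding to `e_{23} + e_{26}` in the paper. -/
noncomputable def g : CliffordAlgebra Q6 := ι Q6 (e 1) * ι Q6 (e 2) + ι Q6 (e 1) * ι Q6 (e 5)

/-- `f = e₃e₅ − e₅e₆`, corresponding to `e_{35} − e_{56}` in the paper. -/
noncomputable def f : CliffordAlgebra Q6 := ι Q6 (e 2) * ι Q6 (e 4) - ι Q6 (e 4) * ι Q6 (e 5)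

/-- In any ring, let `a`, `d`, `p` be pairwise anticommuting with `a² = d² = 1` and `p² = 0`.
Then `ad`, `ap`, `pd` multiply like `i`, `εj`, `εk` in the dual quaternions. -/
theorem dual_quaternion_table_of_anticommute {R : Type*} [Ring R] {a d p : R}
    (ha : a * a = 1) (hd : d * d = 1) (hp : p * p = 0)
    (hda : d * a = -(a * d)) (hpa : p * a = -(a * p)) (hpd : p * d = -(d * p)) :
    (a * d) ^ 2 = -1 ∧ a * d * (a * p) = p * d ∧ a * p * (a * d) = -(p * d) ∧
      a * d * (p * d) = -(a * p) ∧ p * d * (a * d) = a * p ∧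
      (a * p) ^ 2 = 0 ∧ (p * d) ^ 2 = 0 ∧ a * p * (p * d) = 0 ∧ p * d * (a * p) = 0 := by
  have ha' (x : R) : a * (a * x) = x := by rw [← mul_assoc, ha, one_mul]
  have hd' (x : R) : d * (d * x) = x := by rw [← mul_assoc, hd, one_mul]
  have hda' (x : R) : d * (a * x) = -(a * (d * x)) := by
    rw [← mul_assoc, hda, neg_mul, mul_assoc]
  have hpa' (x : R) : p * (a * x) = -(a * (p * x)) := by
    rw [← mul_assoc, hpa, neg_mul, mul_assoc]
  have hpd' (x : R) : p * (d * x) = -(d * (p * x)) := by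
    rw [← mul_assoc, hpd, neg_mul, mul_assoc]
  simp [sq, mul_assoc, ha, hd, hp, hpd, ha', hd', hda', hpa', hpd']

theorem g_eq : g = ι Q6 (e 1) * ι Q6 (e 2 + e 5) := by
  rw [g, map_add, mul_add]

theorem f_eq : f = ι Q6 (e 2 + e 5) * ι Q6 (e 4) := by
  have h : Q6.IsOrtho (e 4) (e 5) := by
    simp [QuadraticMap.isOrtho_def, Q6_apply, e]
  rw [f, map_add, add_mul, ι_mul_ι_comm_of_isOrtho h, sub_neg_eq_add]

/-- the multiplication table of planar displacements, showing that
`span{1, E, g, f}` is a subalgebra isomorphic to the planar dual quaternions via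
`E ↦ i`, `g ↦ εj`, `f ↦ εk`. -/
theorem planar_displacement_multiplication_table :
    E ^ 2 = -1 ∧ E * g = f ∧ g * E = -f ∧ E * f = -g ∧ f * E = g ∧
      g ^ 2 = 0 ∧ f ^ 2 = 0 ∧ g * f = 0 ∧ f * g = 0 := by
  rw [E, g_eq, f_eq]
  apply dual_quaternion_table_of_anticommute
  iterate 3 rw [ι_sq_scalar]; simp [Q6_apply, e]
  all_goals
    apply ι_mul_ι_comm_of_isOrtho
    simp [QuadraticMap.isOrtho_def, Q6_apply, e]
end

section
/- For every (x₀, y₀) ∈ ℝ², the embedded point ι(η(x₀, y₀)) commutes in Cl(4,2) with the 2-blade 𝔭 = 2·ι(e₂)ι(e₅) + x₀·(ι(e₃)ι(e₅) − ι(e₅)ι(e₆)) + y₀·(ι(e₂)ι(e₃) + ι(e₂)ι(e₆)), and likewise ι(e₃ + e₆) commutes with 𝔭; i.e. the geometric inner product null space of 𝔭 contains the point (x₀, y₀) and the point at infinity, so 𝔭 represents the point pair {(x₀, y₀), ∞}. -/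
open CliffordAlgebra

/-- The embedding `η(x, y) = e₁ + x e₂ + ½x² e₃ + e₄ + y e₅ + ½y² e₆`. -/
noncomputable def eta (x y : ℝ) : Fin 6 → ℝ :=
  e 0 + x • e 1 + (x ^ 2 / 2) • e 2 + e 3 + y • e 4 + (y ^ 2 / 2) • e 5

/-- The point representation
`𝔭 = 2e₂e₅ + x₀(e₃e₅ − e₅e₆) + y₀(e₂e₃ + e₂e₆)` of `(x₀, y₀)`. -/
noncomputable def pointRep (x₀ y₀ : ℝ) : CliffordAlgebra Q6 :=
  (2 : ℝ) • (ι Q6 (e 1) * ι Q6 (e 4)) +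
    x₀ • (ι Q6 (e 2) * ι Q6 (e 4) - ι Q6 (e 4) * ι Q6 (e 5)) +
    y₀ • (ι Q6 (e 1) * ι Q6 (e 2) + ι Q6 (e 1) * ι Q6 (e 5))

/-- The commutator of a vector with a product of two vectors is the contraction
`⁅v, ab⁆ = polar Q v a • b - polar Q v b • a`. -/
theorem ι_mul_sub_mul_ι {R M : Type*} [CommRing R] [AddCommGroup M] [Module R M]
    (Q : QuadraticForm R M) (v a b : M) :
    ι Q v * (ι Q a * ι Q b) - ι Q a * ι Q b * ι Q v =
      QuadraticMap.polar Q v a • ι Q b - QuadraticMap.polar Q v b • ι Q a := by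
  have ha := ι_mul_ι_add_swap (Q := Q) v a
  have hb := ι_mul_ι_add_swap (Q := Q) v b
  rw [Algebra.smul_def, Algebra.smul_def, ← ha, Algebra.commutes, ← hb]
  noncomm_ring

/-- The commutator of a vector with the point representation, as a vector. -/
theorem ι_mul_pointRep_sub (v : Fin 6 → ℝ) (x₀ y₀ : ℝ) :
    ι Q6 v * pointRep x₀ y₀ - pointRep x₀ y₀ * ι Q6 v =
      (4 * v 1 + 2 * x₀ * (-v 0 - v 3)) • ι Q6 (e 4) +
        (-4 * v 4 + 2 * y₀ * (v 0 + v 3)) • ι Q6 (e 1) +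
        (2 * y₀ * v 1 - 2 * x₀ * v 4) • (ι Q6 (e 2) + ι Q6 (e 5)) := by
  have expand : ι Q6 v * pointRep x₀ y₀ - pointRep x₀ y₀ * ι Q6 v =
      (2 : ℝ) • (ι Q6 v * (ι Q6 (e 1) * ι Q6 (e 4)) - ι Q6 (e 1) * ι Q6 (e 4) * ι Q6 v) +
      x₀ • ((ι Q6 v * (ι Q6 (e 2) * ι Q6 (e 4)) - ι Q6 (e 2) * ι Q6 (e 4) * ι Q6 v) -
        (ι Q6 v * (ι Q6 (e 4) * ι Q6 (e 5)) - ι Q6 (e 4) * ι Q6 (e 5) * ι Q6 v)) +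
      y₀ • ((ι Q6 v * (ι Q6 (e 1) * ι Q6 (e 2)) - ι Q6 (e 1) * ι Q6 (e 2) * ι Q6 v) +
        (ι Q6 v * (ι Q6 (e 1) * ι Q6 (e 5)) - ι Q6 (e 1) * ι Q6 (e 5) * ι Q6 v)) := by
    simp only [pointRep, mul_add, add_mul, mul_sub, sub_mul, mul_smul_comm, smul_mul_assoc]
    module
  rw [expand]
  simp only [ι_mul_sub_mul_ι, polar_Q6]
  simp [e]
  module

/-- the point `(x₀, y₀)` and the point at infinity `e₃ + e₆` lie in the
geometric inner product null space of the 2-blade `𝔭`: their images commute with `𝔭`,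
so `𝔭` represents the point pair `{(x₀, y₀), ∞}`. -/
theorem pointRep_represents_point_and_infinity (x₀ y₀ : ℝ) :
    ι Q6 (eta x₀ y₀) * pointRep x₀ y₀ = pointRep x₀ y₀ * ι Q6 (eta x₀ y₀) ∧
      ι Q6 (e 2 + e 5) * pointRep x₀ y₀ = pointRep x₀ y₀ * ι Q6 (e 2 + e 5) := by
  constructor <;> rw [← sub_eq_zero, ι_mul_pointRep_sub]
  · simp [eta, e]
    module
  · simp [e]
end

section
/- Let c₀, c₁, c₂, x₀, y₀ ∈ ℝ with c₀ ≠ 0 and r := c₁x₀² + c₂y₀² ≠ 0, and let 𝔭' = −(2y₀c₁/c₀)·ι(e₁)ι(e₂) + (2x₀c₁/c₀)·ι(e₁)ι(e₅) − 2·ι(e₂)ι(e₅) + (2y₀c₂/c₀)·ι(e₂)ι(e₄) + (2x₀c₂/c₀)·ι(e₄)ι(e₅) ∈ Cl(4,2) (the image of the point (x₀, y₀) under inversion in the conic c₁x² + c₂y² + c₀ = 0). Then the point (x', y') with x' = −2c₀x₀/r and y' = −2c₀y₀/r lies in the geometric inner product null space of 𝔭': ι(η(x', y')) · 𝔭' =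 𝔭' · ι(η(x', y')). -/
open CliffordAlgebra

/-- The image `𝔭'` of the point `(x₀, y₀)` under inversion in the conic
`c₁x² + c₂y² + c₀ = 0`:
`𝔭' = −(2y₀c₁/c₀)e₁e₂ + (2x₀c₁/c₀)e₁e₅ − 2e₂e₅ + (2y₀c₂/c₀)e₂e₄ + (2x₀c₂/c₀)e₄e₅`. -/
noncomputable def imagePointRep (c₀ c₁ c₂ x₀ y₀ : ℝ) : CliffordAlgebra Q6 :=
  (-(2 * y₀ * c₁ / c₀)) • (ι Q6 (e 0) * ι Q6 (e 1)) +
    (2 * x₀ * c₁ / c₀) • (ι Q6 (e 0) * ι Q6 (e 4)) +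
    (-2 : ℝ) • (ι Q6 (e 1) * ι Q6 (e 4)) +
    (2 * y₀ * c₂ / c₀) • (ι Q6 (e 1) * ι Q6 (e 3)) +
    (2 * x₀ * c₂ / c₀) • (ι Q6 (e 3) * ι Q6 (e 4))

theorem ι_mul_ι_mul_ι_sub_swap {R M : Type*} [CommRing R] [AddCommGroup M] [Module R M]
    (Q : QuadraticForm R M) (v a b : M) :
    ι Q v * (ι Q a * ι Q b) - ι Q a * ι Q b * ι Q v =
      ι Q (QuadraticMap.polar Q v a • b - QuadraticMap.polar Q v b • a) := by
  have ha := ι_mul_ι_add_swap (Q := Q) v a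
  have hb := ι_mul_ι_add_swap (Q := Q) v b
  rw [map_sub, map_smul, map_smul, Algebra.smul_def, Algebra.smul_def, ← ha,
    Algebra.commutes, ← hb]
  noncomm_ring

/-- the point `(x', y') = (−2c₀x₀/r, −2c₀y₀/r)` with
`r = c₁x₀² + c₂y₀²` lies in the geometric inner product null space of `𝔭'`, i.e.
`ι(η(x', y'))` commutes with `𝔭'`. -/
theorem image_point_in_gipns (c₀ c₁ c₂ x₀ y₀ : ℝ) (h₀ : c₀ ≠ 0)
    (hr : c₁ * x₀ ^ 2 + c₂ * y₀ ^ 2 ≠ 0) :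
    ι Q6 (eta (-2 * c₀ * x₀ / (c₁ * x₀ ^ 2 + c₂ * y₀ ^ 2))
          (-2 * c₀ * y₀ / (c₁ * x₀ ^ 2 + c₂ * y₀ ^ 2))) *
        imagePointRep c₀ c₁ c₂ x₀ y₀ =
      imagePointRep c₀ c₁ c₂ x₀ y₀ *
        ι Q6 (eta (-2 * c₀ * x₀ / (c₁ * x₀ ^ 2 + c₂ * y₀ ^ 2))
          (-2 * c₀ * y₀ / (c₁ * x₀ ^ 2 + c₂ * y₀ ^ 2))) := by
  rw [← sub_eq_zero]
  simp only [imagePointRep, mul_add, add_mul, mul_smul_comm, smul_mul_assoc,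
    add_sub_add_comm, ← smul_sub, ι_mul_ι_mul_ι_sub_swap, ← map_smul, ← map_add]
  convert map_zero (ι Q6)
  simp only [polar_Q6]
  ext i
  fin_cases i <;> simp [eta, e] <;> field_simp <;> ring
end
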